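/- arXiv:1805.09295 — 4 statements merged into one kernel-verified Lean document; each statement's English description precedes it below -/
import Mathlib

section
/- Let (G,y,ỹ) be a GCRN with G=(V,E) and representative vertex set V* ⊆ V such that (G,y,ỹ) is V*-directed and has effective deficiency δ' = 0. Then ker Y ∩ cone(I_{E*}) ⊆ cone(−I_{E^0}), where Y ∈ ℝ^{n×V} is the matrix whose columns are the stoichiometric complexes y(i), cone(W) denotes the set of nonnegative linear combinations of the columns of a matrix W, and I_{E*}, I_{E^0} are the incidence matrices of the effective and phantom edge sets. -/
open scoped BigOperators

attribute [local instance] Classical.propDecidable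

section ChemNet

variable {n : ℕ} {V : Type*} [Fintype V] [DecidableEq V]

/-- Column `e_j - e_i` of the incidence matrix for the edge `p = (i, j)`. -/
def incCol (p : V × V) : V → ℝ := fun u =>
  (if u = p.2 then (1 : ℝ) else 0) - (if u = p.1 then (1 : ℝ) else 0)

/-- Action of the matrix `Y` (with columns `y i`) on a vector `v : V → ℝ`. -/
def Ymap (y : V → Fin n → ℝ) (v : V → ℝ) : Fin n → ℝ := ∑ i, v i • y i

/-- Vector power `x ^ v = ∏ a, x a ^ v a`. -/
noncomputable def vpow (x : Fin n → ℝ) (v : Fin n → ℝ) : ℝ := ∏ a, x a ^ v a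

/-- Right-hand side of the generalized mass-action system. -/
noncomputable def fG (E : Finset (V × V)) (y ty : V → Fin n → ℝ) (k : V × V → ℝ)
    (x : Fin n → ℝ) : Fin n → ℝ :=
  ∑ p ∈ E, (k p * vpow x (ty p.1)) • (y p.2 - y p.1)

/-- Action of the Laplacian `A_k = I_E diag(k) (I_E^s)^T` on `w : V → ℝ`. -/
noncomputable def Amap (E : Finset (V × V)) (k : V × V → ℝ) (w : V → ℝ) : V → ℝ :=
  ∑ p ∈ E, (k p * w p.1) • incCol p

/-- The set of positive equilibria `X_k`. -/
noncomputable def Xset (E : Finset (V × V)) (y ty : V → Fin n → ℝ) (k : V × V → ℝ) :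
    Set (Fin n → ℝ) := {x | (∀ a, 0 < x a) ∧ fG E y ty k x = 0}

/-- The set of complex-balanced equilibria `Z_k`. -/
noncomputable def Zset (E : Finset (V × V)) (ty : V → Fin n → ℝ) (k : V × V → ℝ) :
    Set (Fin n → ℝ) := {x | (∀ a, 0 < x a) ∧ Amap E k (fun i => vpow x (ty i)) = 0}

/-- Replace the rate constants on phantom edges by `σ`, keeping `k` on effective edges. -/
noncomputable def mergeRates (y : V → Fin n → ℝ) (k σ : V × V → ℝ) : V × V → ℝ :=
  fun p => if y p.1 = y p.2 then σ p else k p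

/-- The parametrized set of complex-balanced equilibria `Z̄_k`. -/
noncomputable def Zbar (E : Finset (V × V)) (y ty : V → Fin n → ℝ) (k : V × V → ℝ) :
    Set (Fin n → ℝ) :=
  {x | ∃ σ : V × V → ℝ, (∀ p ∈ E, y p.1 = y p.2 → 0 < σ p) ∧
    x ∈ Zset E ty (mergeRates y k σ)}

/-- The setoid identifying vertices with the same stoichiometric complex. -/
def ySetoid (y : V → Fin n → ℝ) : Setoid V :=
  ⟨fun i j => y i = y j, ⟨fun _ => rfl, fun h => h.symm, fun h1 h2 => h1.trans h2⟩⟩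

noncomputable instance yQuotFintype (y : V → Fin n → ℝ) :
    Fintype (Quotient (ySetoid y)) := Fintype.ofFinite _

/-- The map `y'` of the condensed network. -/
def yQuotMap (y : V → Fin n → ℝ) : Quotient (ySetoid y) → Fin n → ℝ :=
  Quotient.lift y (fun _ _ h => h)

/-- The matrix `Y'` of the condensed network, as a linear map. -/
noncomputable def YQLin (y : V → Fin n → ℝ) :
    (Quotient (ySetoid y) → ℝ) →ₗ[ℝ] (Fin n → ℝ) :=
  (Matrix.of fun (a : Fin n) (c : Quotient (ySetoid y)) => yQuotMap y c a).mulVecLin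

/-- Column `e_{[j]} - e_{[i]}` of the condensed incidence matrix for `p = (i,j)`. -/
noncomputable def incColQ (y : V → Fin n → ℝ) (p : V × V) : Quotient (ySetoid y) → ℝ :=
  fun c => (if c = Quotient.mk (ySetoid y) p.2 then (1 : ℝ) else 0) -
           (if c = Quotient.mk (ySetoid y) p.1 then (1 : ℝ) else 0)

/-- `ker Y' ∩ im I_{E'}`; its dimension is the effective deficiency `δ'`. -/
noncomputable def effDefSpace (y : V → Fin n → ℝ) (E : Finset (V × V)) :
    Submodule ℝ (Quotient (ySetoid y) → ℝ) :=
  LinearMap.ker (YQLin y) ⊓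
    Submodule.span ℝ {w | ∃ p, p ∈ E ∧ y p.1 ≠ y p.2 ∧ w = incColQ y p}

/-- `Vs` is a set of representative vertices: exactly one per `y`-equivalence class. -/
def IsRepSet (y : V → Fin n → ℝ) (Vs : Set V) : Prop :=
  ∀ i : V, ∃! j : V, j ∈ Vs ∧ y j = y i

/-- The GCRN `(E, y)` is `V*`-directed for the representative set `Vs`. -/
def VstarDirected (E : Finset (V × V)) (y : V → Fin n → ℝ) (Vs : Set V) : Prop :=
  IsRepSet y Vs ∧
  (∀ p ∈ E, y p.1 ≠ y p.2 → p.2 ∈ Vs) ∧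
  (∀ p ∈ E, y p.1 = y p.2 → p.1 ∈ Vs) ∧
  (∀ i ∈ Vs, ∀ j : V, y j = y i → j ≠ i → (i, j) ∈ E)

/-- Undirected adjacency relation of the digraph with edge set `E`. -/
def adjRel (E : Finset (V × V)) : V → V → Prop := fun i j => (i, j) ∈ E ∨ (j, i) ∈ E

/-- `connRel E i j` iff `i` and `j` lie in the same linkage class. -/
def connRel (E : Finset (V × V)) : V → V → Prop := Relation.EqvGen (adjRel E)

/-- A digraph is weakly reversible if linkage classes are strongly connected. -/
def WeaklyReversible (E : Finset (V × V)) : Prop :=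
  ∀ i j : V, connRel E i j → Relation.ReflTransGen (fun a b => (a, b) ∈ E) i j

/-- `F` is a spanning forest for the digraph `E`: it has the same linkage classes,
and every edge of `F` is a bridge (so `F` is a forest). -/
def IsSpanningForest (E F : Finset (V × V)) : Prop :=
  (∀ i j : V, connRel F i j ↔ connRel E i j) ∧
  (∀ p ∈ F, ¬ connRel (F.erase p) p.1 p.2)

/-- The vector `v^l` supported on the linkage class of `i0`, with entries `K i`. -/
noncomputable def linkageVec (E : Finset (V × V)) (K : V → ℝ) (i0 : V) : V → ℝ :=
  fun i => if connRel E i0 i then K i else 0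

/-- `ker A_k` is spanned by the vectors `v^1, …, v^ℓ` built from the tree constants `K`. -/
def KernelSpanProp (E : Finset (V × V)) (k' : V × V → ℝ) (K : V → ℝ) : Prop :=
  ∀ w : V → ℝ, Amap E k' w = 0 ↔
    w ∈ Submodule.span ℝ {v : V → ℝ | ∃ i0 : V, v = linkageVec E K i0}

/-- The matrix with columns `ty i`, as a linear map. -/
noncomputable def YLin (ty : V → Fin n → ℝ) : (V → ℝ) →ₗ[ℝ] (Fin n → ℝ) :=
  (Matrix.of fun (a : Fin n) (i : V) => ty i a).mulVecLin

/-- `ker Ỹ ∩ im I_E`; its dimension is the (kinetic) deficiency. -/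
noncomputable def kinDefSpace (ty : V → Fin n → ℝ) (E : Finset (V × V)) :
    Submodule ℝ (V → ℝ) :=
  LinearMap.ker (YLin ty) ⊓ Submodule.span ℝ {w : V → ℝ | ∃ p ∈ E, w = incCol p}

/-- `s̃ = dim im (Ỹ I_E)`. -/
noncomputable def sTilde (ty : V → Fin n → ℝ) (E : Finset (V × V)) : ℕ :=
  Module.finrank ℝ (Submodule.span ℝ {w : Fin n → ℝ | ∃ p ∈ E, w = ty p.2 - ty p.1})

/-- The matrix `M = Ỹ I_𝓔` for the spanning forest with edge set `F`. -/
def Mmat (F : Finset (V × V)) (ty : V → Fin n → ℝ) : Matrix (Fin n) ↥F ℝ :=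
  Matrix.of fun a e => ty (e : V × V).2 a - ty (e : V × V).1 a


theorem aux_ymap {n : ℕ} {V : Type*} [Fintype V] [DecidableEq V] (y : V → Fin n → ℝ)
    (v : V → ℝ) :
    YQLin y (fun c => ∑ u, if Quotient.mk (ySetoid y) u = c then v u else 0) = Ymap y v := by
  funext a
  simp only [YQLin, Matrix.mulVecLin_apply, Matrix.mulVec, dotProduct, Matrix.of_apply, Ymap,
    Finset.sum_apply, Pi.smul_apply, smul_eq_mul, Finset.mul_sum]
  rw [Finset.sum_comm]
  refine Finset.sum_congr rfl fun u _ => ?_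
  rw [Finset.sum_eq_single (Quotient.mk (ySetoid y) u)]
  · rw [if_pos rfl, mul_comm]
    rfl
  · intro c _ hc
    rw [if_neg (Ne.symm hc), mul_zero]
  · simp

theorem aux_inc {n : ℕ} {V : Type*} [Fintype V] [DecidableEq V] (y : V → Fin n → ℝ)
    (p : V × V) (c : Quotient (ySetoid y)) :
    (∑ u, if Quotient.mk (ySetoid y) u = c then incCol p u else 0) = incColQ y p c := by
  have key : ∀ w : V, (∑ u, if Quotient.mk (ySetoid y) u = c then
      (if u = w then (1:ℝ) else 0) else 0) = if c = Quotient.mk (ySetoid y) w then 1 else 0 := by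
    intro w
    rw [Finset.sum_eq_single w]
    · simp [eq_comm]
    · intro b _ hb
      simp [hb]
    · simp
  have : ∀ u, (if Quotient.mk (ySetoid y) u = c then incCol p u else 0) =
      (if Quotient.mk (ySetoid y) u = c then (if u = p.2 then (1:ℝ) else 0) else 0) -
      (if Quotient.mk (ySetoid y) u = c then (if u = p.1 then (1:ℝ) else 0) else 0) := by
    intro u
    by_cases h : Quotient.mk (ySetoid y) u = c <;> simp [h, incCol]
  simp only [this, Finset.sum_sub_distrib, key, incColQ]

/-- Lemma `cones`, first part: for a `V*`-directed GCRN with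
effective deficiency zero, `ker Y ∩ cone I_{E*} ⊆ cone (−I_{E⁰})`. -/
theorem kerY_cone_subset_cone_phantom
    {n : ℕ} {V : Type*} [Fintype V] [DecidableEq V]
    (E : Finset (V × V)) (hE : ∀ p ∈ E, p.1 ≠ p.2)
    (y ty : V → Fin n → ℝ) (Vs : Set V)
    (hdir : VstarDirected E y Vs)
    (hdef : Module.finrank ℝ (effDefSpace y E) = 0)
    (v : V → ℝ)
    (hker : Ymap y v = 0)
    (hcone : ∃ x : V × V → ℝ, (∀ p, 0 ≤ x p) ∧
      (∀ p : V × V, ¬ (p ∈ E ∧ y p.1 ≠ y p.2) → x p = 0) ∧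
      v = ∑ p : V × V, x p • incCol p) :
    ∃ x : V × V → ℝ, (∀ p, 0 ≤ x p) ∧
      (∀ p : V × V, ¬ (p ∈ E ∧ y p.1 = y p.2) → x p = 0) ∧
      v = ∑ p : V × V, x p • (- incCol p) := by
  obtain ⟨x, hx0, hxE, hv⟩ := hcone
  obtain ⟨hrep, heff, hph, hall⟩ := hdir
  have hbot : effDefSpace y E = ⊥ := Submodule.finrank_eq_zero.mp hdef
  have hL : (fun c => ∑ u, if Quotient.mk (ySetoid y) u = c then v u else 0) ∈
      effDefSpace y E := by
    refine ⟨?_, ?_⟩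
    · show YQLin y _ = 0
      rw [aux_ymap, hker]
    · have : (fun c => ∑ u, if Quotient.mk (ySetoid y) u = c then v u else 0) =
          ∑ p : V × V, x p • incColQ y p := by
        funext c
        rw [hv]
        simp only [Finset.sum_apply, Pi.smul_apply, smul_eq_mul, ← aux_inc, Finset.mul_sum]
        rw [Finset.sum_comm]
        refine Finset.sum_congr rfl fun u _ => ?_
        by_cases h : Quotient.mk (ySetoid y) u = c <;> simp [h]
      rw [this]
      refine Submodule.sum_mem _ fun p _ => ?_
      by_cases h : p ∈ E ∧ y p.1 ≠ y p.2
      · exact Submodule.smul_mem _ _ (Submodule.subset_span ⟨p, h.1, h.2, rfl⟩)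
      · rw [hxE p h, zero_smul]
        exact Submodule.zero_mem _
  rw [hbot, Submodule.mem_bot] at hL
  have hsum : ∀ i : V, (∑ u, if y u = y i then v u else 0) = 0 := by
    intro i
    have h := congrFun hL (Quotient.mk (ySetoid y) i)
    simp only [Pi.zero_apply] at h
    refine Eq.trans ?_ h
    refine Finset.sum_congr rfl fun u _ => ?_
    have : (Quotient.mk (ySetoid y) u = Quotient.mk (ySetoid y) i) ↔ y u = y i :=
      ⟨fun h => Quotient.exact h, fun h => Quotient.sound h⟩
    simp only [this]
  have hneg : ∀ u, u ∉ Vs → v u ≤ 0 := by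
    intro u hu
    rw [hv]
    simp only [Finset.sum_apply, Pi.smul_apply, smul_eq_mul]
    refine Finset.sum_nonpos fun p _ => ?_
    by_cases h : p ∈ E ∧ y p.1 ≠ y p.2
    · have hne : u ≠ p.2 := fun e => hu (e ▸ heff p h.1 h.2)
      refine mul_nonpos_of_nonneg_of_nonpos (hx0 p) ?_
      simp only [incCol, if_neg hne]
      split_ifs <;> norm_num
    · simp [hxE p h]
  have huniq : ∀ i j, i ∈ Vs → j ∈ Vs → y j = y i → j = i := by
    intro i j hi hj hy
    exact (hrep i).unique ⟨hj, hy⟩ ⟨hi, rfl⟩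
  refine ⟨fun p => if p.1 ∈ Vs ∧ y p.2 = y p.1 ∧ p.2 ≠ p.1 then - v p.2 else 0, ?_, ?_, ?_⟩
  · intro p
    dsimp only
    split_ifs with h
    · have : p.2 ∉ Vs := fun h2 => h.2.2 (huniq _ _ h.1 h2 h.2.1)
      linarith [hneg _ this]
    · exact le_rfl
  · intro p hp
    dsimp only
    rw [if_neg]
    rintro ⟨h1, h2, h3⟩
    exact hp ⟨hall p.1 h1 p.2 h2 h3, h2.symm⟩
  · funext u
    have gen : ∀ f : V × V → ℝ, (∑ p : V × V, f p • (- incCol p)) u =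
        ∑ j, f (u, j) - ∑ i, f (i, u) := by
      intro f
      simp only [Finset.sum_apply, Pi.smul_apply, Pi.neg_apply, smul_eq_mul, incCol, neg_sub,
        mul_sub, Finset.sum_sub_distrib, Fintype.sum_prod_type]
      congr 1
      · rw [Finset.sum_eq_single u]
        · simp
        · intro b _ hb
          simp [Ne.symm hb]
        · simp
      · refine Finset.sum_congr rfl fun i _ => ?_
        rw [Finset.sum_eq_single u]
        · simp
        · intro b _ hb
          simp [Ne.symm hb]
        · simp
    rw [gen]
    dsimp only
    by_cases hu : u ∈ Vs
    · have h2 : ∀ i, (if i ∈ Vs ∧ y u = y i ∧ u ≠ i then - v u else 0) = 0 := by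
        intro i
        rw [if_neg]
        rintro ⟨a, b, c⟩
        exact c (huniq _ _ a hu b)
      have h1 : ∀ j, (if u ∈ Vs ∧ y j = y u ∧ j ≠ u then - v j else 0) =
          (if j = u then v u else 0) - (if y j = y u then v j else 0) := by
        intro j
        by_cases hj : j = u
        · subst hj; simp
        · by_cases hy : y j = y u <;> simp [hu, hj, hy]
      rw [Finset.sum_congr rfl fun j _ => h1 j, Finset.sum_congr rfl fun j _ => h2 j,
        Finset.sum_sub_distrib, hsum u]
      simp
    · obtain ⟨r, ⟨hr, hry⟩, -⟩ := hrep u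
      have hne : u ≠ r := fun e => hu (e ▸ hr)
      rw [Finset.sum_eq_zero (fun j _ => if_neg fun h => hu h.1),
        Finset.sum_eq_single r]
      · rw [if_pos ⟨hr, hry.symm, hne⟩]; ring
      · intro b _ hb
        rw [if_neg]
        rintro ⟨h1, h2, -⟩
        exact hb (huniq _ _ hr h1 (h2.symm.trans hry.symm))
      · simp

end ChemNet
end

section
/- Let (G,y,ỹ) be a GCRN with G = (V,E) and representative vertex set V* ⊆ V, and let k ∈ ℝ^E_{>0}. Then there exists a GCRN (G̃,y,ỹ) with G̃ = (V,Ẽ) on the same vertex set that is V*-directed, together with a rate vector k̃ ∈ ℝ^{Ẽ}_{>0}, such that the GMASs (G_k,y,ỹ) and (G̃_{k̃},y,ỹ) are dynamically equivalent, i.e., f_k^G(x) = f_{k̃}^{G̃}(x) for all x ∈ ℝ^n_{>0}. -/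
open scoped BigOperators

attribute [local instance] Classical.propDecidable

section ChemNet

variable {n : ℕ} {V : Type*} [Fintype V] [DecidableEq V]

/-- Lemma `equiv2`, network redirection: every GMAS is dynamically
equivalent to a `V*`-directed GMAS on the same vertex set. -/
theorem exists_Vstar_directed_dynamically_equivalent
    {n : ℕ} {V : Type*} [Fintype V] [DecidableEq V]
    (E : Finset (V × V)) (hE : ∀ p ∈ E, p.1 ≠ p.2)
    (y ty : V → Fin n → ℝ) (Vs : Set V)
    (hrep : IsRepSet y Vs)
    (k : V × V → ℝ) (hk : ∀ p ∈ E, 0 < k p) :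
    ∃ (Et : Finset (V × V)) (kt : V × V → ℝ),
      (∀ p ∈ Et, p.1 ≠ p.2) ∧
      VstarDirected Et y Vs ∧
      (∀ p ∈ Et, 0 < kt p) ∧
      ∀ x : Fin n → ℝ, (∀ a, 0 < x a) → fG E y ty k x = fG Et y ty kt x := by
  choose r hr using fun i => (hrep i).exists
  have hr1 : ∀ i, r i ∈ Vs := fun i => (hr i).1
  have hr2 : ∀ i, y (r i) = y i := fun i => (hr i).2
  let F : Finset (V × V) := E.filter (fun p => y p.1 ≠ y p.2)
  let φ : V × V → V × V := fun p => (p.1, r p.2)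
  let P : Finset (V × V) :=
    Finset.univ.filter (fun p => p.1 ∈ Vs ∧ y p.1 = y p.2 ∧ p.1 ≠ p.2)
  let kt : V × V → ℝ := fun p =>
    if y p.1 = y p.2 then 1 else ∑ q ∈ F.filter (fun q => φ q = p), k q
  have hF : ∀ p, p ∈ F ↔ p ∈ E ∧ y p.1 ≠ y p.2 := fun p => Finset.mem_filter
  have hP : ∀ p, p ∈ P ↔ p.1 ∈ Vs ∧ y p.1 = y p.2 ∧ p.1 ≠ p.2 := fun p => by
    simp [P]
  have hI : ∀ p ∈ F.image φ, y p.1 ≠ y p.2 ∧ p.2 ∈ Vs := by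
    intro p hp
    obtain ⟨q, hq, rfl⟩ := Finset.mem_image.1 hp
    refine ⟨?_, hr1 _⟩
    show y q.1 ≠ y (r q.2)
    rw [hr2]
    exact ((hF q).1 hq).2
  refine ⟨F.image φ ∪ P, kt, ?_, ⟨hrep, ?_, ?_, ?_⟩, ?_, ?_⟩
  · intro p hp h
    rcases Finset.mem_union.1 hp with hp | hp
    · exact (hI p hp).1 (by rw [h])
    · exact ((hP p).1 hp).2.2 h
  · intro p hp h
    rcases Finset.mem_union.1 hp with hp | hp
    · exact (hI p hp).2
    · exact absurd ((hP p).1 hp).2.1 h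
  · intro p hp h
    rcases Finset.mem_union.1 hp with hp | hp
    · exact absurd h (hI p hp).1
    · exact ((hP p).1 hp).1
  · intro i hi j hj hne
    exact Finset.mem_union_right _ ((hP _).2 ⟨hi, hj.symm, hne.symm⟩)
  · intro p hp
    by_cases h : y p.1 = y p.2
    · simp [kt, h]
    · rcases Finset.mem_union.1 hp with hp | hp
      · obtain ⟨q, hq, hqp⟩ := Finset.mem_image.1 hp
        simp only [kt, if_neg h]
        refine Finset.sum_pos ?_ ⟨q, Finset.mem_filter.2 ⟨hq, hqp⟩⟩
        intro s hs
        exact hk s ((hF s).1 (Finset.mem_filter.1 hs).1).1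
      · exact absurd ((hP p).1 hp).2.1 h
  · intro x _
    unfold fG
    have h1 : ∑ p ∈ E, (k p * vpow x (ty p.1)) • (y p.2 - y p.1)
        = ∑ p ∈ F, (k p * vpow x (ty p.1)) • (y p.2 - y p.1) := by
      symm
      refine Finset.sum_subset (Finset.filter_subset _ _) ?_
      intro p hp hn
      have h : y p.1 = y p.2 := by
        by_contra h
        exact hn ((hF p).2 ⟨hp, h⟩)
      rw [h, sub_self, smul_zero]
    have h2 : ∑ p ∈ F.image φ ∪ P, (kt p * vpow x (ty p.1)) • (y p.2 - y p.1)
        = ∑ p ∈ F.image φ, (kt p * vpow x (ty p.1)) • (y p.2 - y p.1) := by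
      symm
      refine Finset.sum_subset Finset.subset_union_left ?_
      intro p hp hn
      have h := ((hP p).1 ((Finset.mem_union.1 hp).resolve_left hn)).2.1
      rw [h, sub_self, smul_zero]
    rw [h1, h2, ← Finset.sum_fiberwise_of_maps_to
      (fun p hp => Finset.mem_image_of_mem φ hp)]
    refine Finset.sum_congr rfl ?_
    intro p hp
    simp only [kt, if_neg (hI p hp).1]
    rw [Finset.sum_mul, Finset.sum_smul]
    refine Finset.sum_congr (by congr) ?_
    intro q hq
    have hqp : φ q = p := (Finset.mem_filter.1 hq).2
    subst hqp
    show _ = (k q * vpow x (ty q.1)) • (y (r q.2) - y q.1)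
    rw [hr2]

end ChemNet
end

section
/- Let (G,y) be a CRN with G = (V,E) and rate vector k ∈ ℝ^E_{>0}. Let the GCRN (G^T, y^T, ỹ^T) with G^T = (V^T, E^T) be a translation of (G,y) via a map g: E → E^T, and define k^T ∈ ℝ^{E^T}_{>0} by k^T_{i^T→j^T} = Σ_{i→j ∈ E : g(i→j) = i^T→j^T} k_{i→j} (in particular, if g is a bijection, k^T_{g(i→j)} = k_{i→j}). Then the MAS (G_k,y) and the GMAS (G^T_{k^T}, y^T, ỹ^T) are dynamically equivalent: f_k^G(x) = f_{k^T}^{G^T}(x) for all x ∈ ℝ^n_{>0}. -/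
open scoped BigOperators

attribute [local instance] Classical.propDecidable

section ChemNet

variable {n : ℕ} {V : Type*} [Fintype V] [DecidableEq V]

/-- Lemma `equiv1`, network translation: if the GCRN
`(Gᵀ, yᵀ, ỹᵀ)` is a translation of the CRN `(G, y)` via `g`, and the rate
constants are transported by summing over the fibers of `g`, then the MAS and
the translated GMAS are dynamically equivalent. -/
theorem translation_dynamically_equivalent
    {n : ℕ} {V VT : Type*} [Fintype V] [DecidableEq V] [Fintype VT] [DecidableEq VT]
    (E : Finset (V × V)) (hE : ∀ p ∈ E, p.1 ≠ p.2)
    (y : V → Fin n → ℝ) (hy : Function.Injective y)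
    (ET : Finset (VT × VT)) (hET : ∀ q ∈ ET, q.1 ≠ q.2)
    (yT tyT : VT → Fin n → ℝ)
    (g : V × V → VT × VT)
    (hg : ∀ p ∈ E, g p ∈ ET)
    (hg1 : ∀ p ∈ E, yT (g p).2 - yT (g p).1 = y p.2 - y p.1)
    (hg2 : ∀ p ∈ E, tyT (g p).1 = y p.1)
    (k : V × V → ℝ) (hk : ∀ p ∈ E, 0 < k p)
    (kT : VT × VT → ℝ)
    (hkT : ∀ q ∈ ET, kT q = ∑ p ∈ E.filter (fun p => g p = q), k p) :
    ∀ x : Fin n → ℝ, (∀ a, 0 < x a) → fG E y y k x = fG ET yT tyT kT x := by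
  intro x _
  unfold fG
  rw [← Finset.sum_fiberwise_of_maps_to hg]
  refine Finset.sum_congr rfl fun q hq => ?_
  rw [hkT q hq, Finset.sum_mul, Finset.sum_smul]
  refine Finset.sum_congr (by congr) fun p hp => ?_
  obtain ⟨hpE, rfl⟩ := Finset.mem_filter.mp hp
  rw [hg1 p hpE, hg2 p hpE]


end ChemNet
end

section
/- Let (G,y,ỹ) be a GCRN with G = (V,E) and effective deficiency δ' = 0. If v = I_{E*} x for some nonnegative weight vector x ∈ ℝ^{E*}_{≥0} on the effective edges and Y v = 0 (where Y ∈ ℝ^{n×V} has columns y(i)), then for every equivalence class [i] = {j ∈ V : y(j) = y(i)} one has Σ_{i'∈[i]} v_{i'} = 0. -/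
open scoped BigOperators

attribute [local instance] Classical.propDecidable

section ChemNet

variable {n : ℕ} {V : Type*} [Fintype V] [DecidableEq V]

/-- for a GCRN with effective deficiency zero, if
`v = I_{E*} x` with nonnegative weights `x` on the effective edges and `Y v = 0`,
then the coordinates of `v` sum to zero over every `y`-equivalence class. -/
theorem class_sums_vanish_of_effective_deficiency_zero
    {n : ℕ} {V : Type*} [Fintype V] [DecidableEq V]
    (E : Finset (V × V)) (hE : ∀ p ∈ E, p.1 ≠ p.2)
    (y ty : V → Fin n → ℝ)
    (hdef : Module.finrank ℝ (effDefSpace y E) = 0)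
    (x : V × V → ℝ) (hx : ∀ p, 0 ≤ x p)
    (hsupp : ∀ p : V × V, ¬ (p ∈ E ∧ y p.1 ≠ y p.2) → x p = 0)
    (v : V → ℝ) (hv : v = ∑ p : V × V, x p • incCol p)
    (hker : Ymap y v = 0) :
    ∀ i : V, ∑ i' ∈ Finset.univ.filter (fun j : V => y j = y i), v i' = 0 := by
  intro i
  have hbot : effDefSpace y E = ⊥ := Submodule.finrank_eq_zero.mp hdef
  let q : V → Quotient (ySetoid y) := fun j => Quotient.mk (ySetoid y) j
  let w : Quotient (ySetoid y) → ℝ := fun c => ∑ j, if q j = c then v j else 0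
  have hw1 : w = ∑ p : V × V, x p • incColQ y p := by
    funext c
    have hcol : ∀ p : V × V, (∑ j, if q j = c then incCol p j else 0) = incColQ y p c := by
      intro p
      have e : ∀ a : V, (∑ j, if q j = c then (if j = a then (1 : ℝ) else 0) else 0)
          = if c = q a then 1 else 0 := by
        intro a
        rw [Finset.sum_eq_single a]
        · simp [eq_comm]
        · intro b _ hb
          simp [hb]
        · simp
      unfold incColQ
      have e2 := e p.2
      have e1 := e p.1
      simp only [q] at e1 e2
      rw [← e1, ← e2, ← Finset.sum_sub_distrib]
      refine Finset.sum_congr rfl fun j _ => ?_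
      by_cases h : q j = c
      · have h' : Quotient.mk (ySetoid y) j = c := h
        simp only [h, h', if_true, incCol]
      · have h' : ¬ Quotient.mk (ySetoid y) j = c := h
        simp only [h, h', if_false, sub_zero]
    simp only [w, hv, Finset.sum_apply, Pi.smul_apply, smul_eq_mul, ← hcol, Finset.mul_sum]
    rw [Finset.sum_comm]
    refine Finset.sum_congr rfl fun j _ => ?_
    by_cases h : q j = c <;> simp [h]
  have hw2 : w ∈ Submodule.span ℝ {w | ∃ p, p ∈ E ∧ y p.1 ≠ y p.2 ∧ w = incColQ y p} := by
    rw [hw1]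
    refine Submodule.sum_mem _ fun p _ => ?_
    by_cases h : p ∈ E ∧ y p.1 ≠ y p.2
    · exact Submodule.smul_mem _ _ (Submodule.subset_span ⟨p, h.1, h.2, rfl⟩)
    · rw [hsupp p h, zero_smul]
      exact Submodule.zero_mem _
  have hw3 : w ∈ LinearMap.ker (YQLin y) := by
    rw [LinearMap.mem_ker, ← hker]
    funext a
    simp only [YQLin, Matrix.mulVecLin_apply, Matrix.mulVec, dotProduct, Matrix.of_apply, Ymap,
      Finset.sum_apply, Pi.smul_apply, smul_eq_mul, w, Finset.mul_sum]
    rw [Finset.sum_comm]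
    refine Finset.sum_congr rfl fun j _ => ?_
    rw [Finset.sum_eq_single (q j)]
    · simp only [if_true]
      rw [mul_comm]
      rfl
    · intro c _ hc
      rw [if_neg (Ne.symm hc), mul_zero]
    · simp
  have hw0 : w = 0 := by
    have : w ∈ effDefSpace y E := ⟨hw3, hw2⟩
    rwa [hbot, Submodule.mem_bot] at this
  have h := congrFun hw0 (q i)
  simp only [w, Pi.zero_apply] at h
  rw [← h, Finset.sum_filter]
  refine Finset.sum_congr rfl fun j _ => ?_
  have hiff : q j = q i ↔ y j = y i := Quotient.eq (r := ySetoid y)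
  by_cases hy : y j = y i
  · rw [if_pos hy, if_pos (hiff.mpr hy)]
  · rw [if_neg hy, if_neg (fun hh => hy (hiff.mp hh))]

end ChemNet
end
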